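/- For every integer r ≥ 3 and integers n₁ ≥ n₂ ≥ ⋯ ≥ n_r ≥ 1, the anti-Ramsey number of the 4-cycle C₄ in the complete r-partite graph K_{n₁,n₂,…,n_r} equals n₁ + n₂ + ⋯ + n_r + t − 1, where t = min{ ⌊(n₁+⋯+n_r)/3⌋, ⌊(n₂+⋯+n_r)/2⌋, n₃+⋯+n_r }. -/

import Mathlib

open Finset

/-- The complete `r`-partite graph with parts of sizes `n 0, n 1, …, n (r-1)`. -/
def Kpartite (r : ℕ) (n : ℕ → ℕ) : SimpleGraph ((i : Fin r) × Fin (n i)) :=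
  SimpleGraph.completeMultipartiteGraph fun i : Fin r => Fin (n i)

/-- The edge-coloring `c` contains a rainbow 3-cycle in `G`. -/
def RainbowC3 {V α : Type*} (G : SimpleGraph V) (c : Sym2 V → α) : Prop :=
  ∃ a b d : V, G.Adj a b ∧ G.Adj b d ∧ G.Adj d a ∧
    c s(a, b) ≠ c s(b, d) ∧ c s(b, d) ≠ c s(d, a) ∧ c s(a, b) ≠ c s(d, a)

/-- The edge-coloring `c` contains a rainbow 4-cycle in `G`. -/
def RainbowC4 {V α : Type*} (G : SimpleGraph V) (c : Sym2 V → α) : Prop :=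
  ∃ a b d e : V, G.Adj a b ∧ G.Adj b d ∧ G.Adj d e ∧ G.Adj e a ∧
    a ≠ d ∧ b ≠ e ∧
    c s(a, b) ≠ c s(b, d) ∧ c s(a, b) ≠ c s(d, e) ∧ c s(a, b) ≠ c s(e, a) ∧
    c s(b, d) ≠ c s(d, e) ∧ c s(b, d) ≠ c s(e, a) ∧ c s(d, e) ≠ c s(e, a)

/-- The coloring `c` uses every one of the `k` colors on at least one edge of `G`
(i.e. it uses exactly `k` colors). -/
def SurjOnEdges {V : Type*} {k : ℕ} (G : SimpleGraph V) (c : Sym2 V → Fin k) : Prop :=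
  ∀ i : Fin k, ∃ e ∈ G.edgeSet, c e = i

section LocalStructure

variable {V ι α : Type*}

/-- In the complete multipartite graph with part map `p`, coloured by `f`, no 4-cycle is rainbow. -/
def NoRainbowC4 (p : V → ι) (f : V → V → α) : Prop :=
  ∀ a b d e, p a ≠ p b → p b ≠ p d → p d ≠ p e → p e ≠ p a → a ≠ d → b ≠ e →
    f a b = f b d ∨ f a b = f d e ∨ f a b = f e a ∨ f b d = f d e ∨ f b d = f e a ∨ f d e = f e a

/-- `u v` is an edge whose colour appears only on edges at `u`. -/
def Arrow (p : V → ι) (f : V → V → α) (u v : V) : Prop :=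
  p u ≠ p v ∧ ∀ x y, p x ≠ p y → f x y = f u v → x = u ∨ y = u

/-- Every edge of colour `κ` meets `{x, y, z}`. -/
def TripleSaturated (p : V → ι) (f : V → V → α) (x y z : V) (κ : α) : Prop :=
  ∀ u v, p u ≠ p v → f u v = κ → u = x ∨ u = y ∨ u = z ∨ v = x ∨ v = y ∨ v = z

variable {p : V → ι} {f : V → V → α}

theorem Arrow.ne {u v x y : V} (h : Arrow p f u v) (hxy : p x ≠ p y) (hx : x ≠ u) (hy : y ≠ u) :
    f x y ≠ f u v := fun he => (h.2 x y hxy he).elim hx hy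

theorem directed_triangle_neighbor (hf : ∀ u v, f u v = f v u) (hC : NoRainbowC4 p f)
    {x y z v : V} (hxy : Arrow p f x y) (hyz : Arrow p f y z) (hzx : Arrow p f z x)
    {κ : α} (h1 : κ ≠ f x y) (h2 : κ ≠ f y z) (h3 : κ ≠ f z x)
    (hvx : v ≠ x) (hvy : v ≠ y) (hvz : v ≠ z) (hp : p x ≠ p v) (hv : f x v = κ) :
    (p v ≠ p z → f z v = κ) ∧ (p v ≠ p y → f y v = f y z ∨ f y v = κ) := by
  have n1 := hxy.ne hyz.1 (by grind [Arrow]) (by grind [Arrow])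
  have n2 := hyz.ne hzx.1 (by grind [Arrow]) (by grind [Arrow])
  have n3 := hzx.ne hxy.1 (by grind [Arrow]) (by grind [Arrow])
  have d1 := hxy.1
  have d2 := hyz.1
  have d3 := hzx.1
  constructor
  · intro h
    have := hC v x y z hp.symm d1 d2 h.symm hvy (by grind)
    have m1 := hxy.ne h hvx (by grind)
    have m2 := hyz.ne h hvy (by grind)
    grind
  · intro h
    have := hC y z x v d2 d3 hp h (by grind) (by grind)
    have m1 := hzx.ne h hvz (by grind)
    grind

theorem directed_triangle_common_vertex_false (hf : ∀ u v, f u v = f v u) (hC : NoRainbowC4 p f)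
    (hs : ∀ v κ, ∃ w, Arrow p f v w ∧ f v w ≠ κ)
    {x y z v w : V} (hxy : Arrow p f x y) (hyz : Arrow p f y z) (hzx : Arrow p f z x)
    {κ μ : α} (hκ : TripleSaturated p f x y z κ) (hμ : TripleSaturated p f x y z μ) (hne : κ ≠ μ)
    (h1 : κ ≠ f x y) (h2 : κ ≠ f y z) (h3 : κ ≠ f z x)
    (hvx : v ≠ x) (hvy : v ≠ y) (hvz : v ≠ z) (hwx : w ≠ x) (hwy : w ≠ y) (hwz : w ≠ z)
    (hp : p x ≠ p v) (hv : f x v = κ) (hw : f x w = μ) (hvw : p v = p w) : False := by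
  obtain ⟨a, b⟩ := directed_triangle_neighbor hf hC hxy hyz hzx h1 h2 h3 hvx hvy hvz hp hv
  obtain ⟨u, hu, huκ⟩ := hs v κ
  have d := hu.1
  have uz : u ≠ z := by grind
  have ux : u ≠ x := by grind
  have uy : u ≠ y := by
    rintro rfl
    rcases b d with h | h
    · exact hu.ne hyz.1 hvy.symm hvz.symm (by grind)
    · grind
  have hwv : w ≠ v := by grind
  have := hC u v x w d.symm hp.symm (by grind) (by grind) ux hwv.symm
  have m1 := hu.ne (x := x) (y := w) (by grind) hvx.symm hwv
  have m2 := hu.ne (x := w) (y := u) (by grind) hwv (by grind)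
  have m3 := hκ w u (by grind)
  have m4 := hμ w u (by grind)
  grind

theorem directed_triangle_adjacent_false (hf : ∀ u v, f u v = f v u) (hC : NoRainbowC4 p f)
    {x y z v w : V} (hxy : Arrow p f x y) (hzx : Arrow p f z x)
    {κ μ : α} (hκ : TripleSaturated p f x y z κ) (hμ : TripleSaturated p f x y z μ) (hne : κ ≠ μ)
    (h1 : κ ≠ f x y) (h3 : κ ≠ f z x)
    (k1 : μ ≠ f x y) (k3 : μ ≠ f z x)
    (hvx : v ≠ x) (hvy : v ≠ y) (hvz : v ≠ z) (hwx : w ≠ x) (hwy : w ≠ y) (hwz : w ≠ z)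
    (hp : p x ≠ p v) (hv : f x v = κ) (hvw : p v ≠ p w) :
    (p y ≠ p w → f y w ≠ μ) ∧ (p z ≠ p w → f z w ≠ μ) := by
  have m3 := hκ v w hvw
  have m4 := hμ v w hvw
  have d1 := hxy.1
  have d3 := hzx.1
  constructor
  · intro h h'
    have := hC v x y w hp.symm d1 h hvw.symm hvy hwx.symm
    have := hxy.ne hvw hvx hwx
    grind
  · intro h h'
    have := hC v x z w hp.symm d3.symm h hvw.symm hvz hwx.symm
    have := hzx.ne hvw hvz hwz
    grind

theorem TripleSaturated.rotate {x y z : V} {κ : α} (h : TripleSaturated p f x y z κ) :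
    TripleSaturated p f y z x κ := fun u v huv he => by
  have := h u v huv he
  tauto

theorem directed_triangle_pair_false (hf : ∀ u v, f u v = f v u) (hC : NoRainbowC4 p f)
    (hs : ∀ v κ, ∃ w, Arrow p f v w ∧ f v w ≠ κ)
    {x y z v w t : V} (hxy : Arrow p f x y) (hyz : Arrow p f y z) (hzx : Arrow p f z x)
    {κ μ : α} (hκ : TripleSaturated p f x y z κ) (hμ : TripleSaturated p f x y z μ) (hne : κ ≠ μ)
    (h1 : κ ≠ f x y) (h2 : κ ≠ f y z) (h3 : κ ≠ f z x)
    (k1 : μ ≠ f x y) (k2 : μ ≠ f y z) (k3 : μ ≠ f z x)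
    (hvx : v ≠ x) (hvy : v ≠ y) (hvz : v ≠ z) (hwx : w ≠ x) (hwy : w ≠ y) (hwz : w ≠ z)
    (hp : p x ≠ p v) (hv : f x v = κ) (ht : t = x ∨ t = y ∨ t = z)
    (hpt : p t ≠ p w) (hw : f t w = μ) : False := by
  have d1 := hxy.1
  have d2 := hyz.1
  have d3 := hzx.1
  obtain ⟨a, b⟩ := directed_triangle_neighbor hf hC hxy hyz hzx h1 h2 h3 hvx hvy hvz hp hv
  by_cases hvw : p v = p w
  · rcases ht with rfl | rfl | rfl
    · exact directed_triangle_common_vertex_false hf hC hs hxy hyz hzx hκ hμ hne h1 h2 h3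
        hvx hvy hvz hwx hwy hwz hp hv hw hvw
    · obtain ⟨a', -⟩ := directed_triangle_neighbor hf hC hyz hzx hxy k2 k3 k1 hwy hwz hwx hpt hw
      exact directed_triangle_common_vertex_false hf hC hs hxy hyz hzx hκ hμ hne h1 h2 h3
        hvx hvy hvz hwx hwy hwz hp hv (a' (by grind)) hvw
    · exact directed_triangle_common_vertex_false hf hC hs hzx hxy hyz hκ.rotate.rotate
        hμ.rotate.rotate hne h3 h1 h2 hvz hvx hvy hwz hwx hwy (by grind) (a (by grind)) hw hvw
  · have A := directed_triangle_adjacent_false hf hC hxy hzx hκ hμ hne h1 h3 k1 k3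
      hvx hvy hvz hwx hwy hwz hp hv hvw
    rcases ht with rfl | rfl | rfl
    · obtain ⟨a', -⟩ := directed_triangle_neighbor hf hC hxy hyz hzx k1 k2 k3 hwx hwy hwz hpt hw
      have A' := directed_triangle_adjacent_false hf hC hxy hzx hμ hκ hne.symm k1 k3 h1 h3
        hwx hwy hwz hvx hvy hvz hpt hw (Ne.symm hvw)
      have e1 : p v = p z := by_contra fun h => A'.2 (Ne.symm h) (a h)
      have e2 : p w = p z := by_contra fun h => A.2 (Ne.symm h) (a' h)
      exact hvw (e1.trans e2.symm)
    · exact A.1 hpt hw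
    · exact A.2 hpt hw

theorem directed_triangle_saturated_unique (hf : ∀ u v, f u v = f v u) (hC : NoRainbowC4 p f)
    (hs : ∀ v κ, ∃ w, Arrow p f v w ∧ f v w ≠ κ)
    {x y z s t v w : V} (hxy : Arrow p f x y) (hyz : Arrow p f y z) (hzx : Arrow p f z x)
    (hκ : TripleSaturated p f x y z (f s v)) (hμ : TripleSaturated p f x y z (f t w))
    (h1 : f s v ≠ f x y) (h2 : f s v ≠ f y z) (h3 : f s v ≠ f z x)
    (k1 : f t w ≠ f x y) (k2 : f t w ≠ f y z) (k3 : f t w ≠ f z x)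
    (hsv : p s ≠ p v) (htw : p t ≠ p w) : f s v = f t w := by
  by_contra hne
  wlog hsT : s = x ∨ s = y ∨ s = z generalizing s v
  · have hT := hκ s v hsv rfl
    rw [hf s v] at *
    exact this hκ h1 h2 h3 hsv.symm hne (by tauto)
  wlog htT : t = x ∨ t = y ∨ t = z generalizing t w
  · have hT := hμ t w htw rfl
    rw [hf t w] at *
    exact this hμ k1 k2 k3 htw.symm hne (by tauto)
  have hv : v ≠ x ∧ v ≠ y ∧ v ≠ z := by grind
  have hw : w ≠ x ∧ w ≠ y ∧ w ≠ z := by grind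
  obtain ⟨v1, v2, v3⟩ := hv
  obtain ⟨w1, w2, w3⟩ := hw
  rcases hsT with rfl | rfl | rfl
  · exact directed_triangle_pair_false hf hC hs hxy hyz hzx hκ hμ hne h1 h2 h3 k1 k2 k3
      v1 v2 v3 w1 w2 w3 hsv rfl htT htw rfl
  · exact directed_triangle_pair_false hf hC hs hyz hzx hxy hκ.rotate hμ.rotate hne h2 h3 h1
      k2 k3 k1 v2 v3 v1 w2 w3 w1 hsv rfl (by tauto) htw rfl
  · exact directed_triangle_pair_false hf hC hs hzx hxy hyz hκ.rotate.rotate hμ.rotate.rotate hne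
      h3 h1 h2 k3 k1 k2 v3 v1 v2 w3 w1 w2 hsv rfl (by tauto) htw rfl

/-- A directed path with seven vertices (the last may coincide with the first) in which vertices
at distance three lie in the same part and vertices at distance two are joined in colour `d`. -/
structure Chain (p : V → ι) (f : V → V → α) (d : α) (v : ℕ → V) : Prop where
  arrow : ∀ i, Arrow p f (v i) (v (i + 1))
  part : ∀ i, p (v i) = p (v (i + 3))
  chord : ∀ i, f (v i) (v (i + 2)) = d
  ne : ∀ i j, i < j → j < i + 6 → v i ≠ v j
  arrow_ne : ∀ x y, Arrow p f x y → f x y ≠ d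

namespace Chain

variable {d κ : α} {v : ℕ → V} {u : V}

theorem not_saturated_of_middle (h : Chain p f d v) (hf : ∀ u v, f u v = f v u)
    (hC : NoRainbowC4 p f) (hs : ∀ v κ, ∃ w, Arrow p f v w ∧ f v w ≠ κ)
    (hκ : TripleSaturated p f (v 2) (v 3) (v 4) κ)
    (h1 : κ ≠ f (v 1) (v 2)) (h2 : κ ≠ f (v 2) (v 3)) (h3 : κ ≠ f (v 3) (v 4)) (hd : κ ≠ d)
    (hu : p (v 3) ≠ p u) : f (v 3) u ≠ κ := by
  intro he
  have a1 := h.arrow 1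
  have a2 := h.arrow 2
  have a3 := h.arrow 3
  have a4 := h.arrow 4
  have c1 := h.chord 1
  have c2 := h.chord 2
  have c3 := h.chord 3
  have p2 := h.part 2
  have n12 := h.ne 1 2 (by simp) (by simp)
  have n13 := h.ne 1 3 (by simp) (by simp)
  have n14 := h.ne 1 4 (by simp) (by simp)
  have n24 := h.ne 2 4 (by simp) (by simp)
  have n23 := h.ne 2 3 (by simp) (by simp)
  have n34 := h.ne 3 4 (by simp) (by simp)
  have n25 := h.ne 2 5 (by simp) (by simp)
  have n35 := h.ne 3 5 (by simp) (by simp)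
  have n45 := h.ne 4 5 (by simp) (by simp)
  simp only [Nat.reduceAdd] at *
  have u1 : u ≠ v 1 := by grind
  have u5 : u ≠ v 5 := by grind
  have u2 : u ≠ v 2 := by grind
  have u3 : u ≠ v 3 := by grind
  have u4 : u ≠ v 4 := by grind
  have pu : p u = p (v 5) := by
    by_contra hp
    have := hC u (v 3) (v 4) (v 5) hu.symm a3.1 a4.1 (Ne.symm hp) u4 n35
    have := a3.ne hp u3 n35.symm
    have := a4.ne hp u4 n45.symm
    have := a4.ne hu (by grind) u4
    have := a3.ne a4.1 (by grind) (by grind)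
    have := hκ u (v 5) hp
    grind
  have pu1 : p u ≠ p (v 1) := by have := a1.1; grind
  have fu1 : f u (v 1) = f (v 1) (v 2) := by
    have := hC u (v 3) (v 2) (v 1) hu.symm a2.1.symm a1.1.symm (Ne.symm pu1) u2 n13.symm
    have := a2.ne pu1 u2 n12
    have := hκ u (v 1) pu1
    have := a1.ne a2.1 n12.symm n13.symm
    grind
  obtain ⟨y, hy, hyne⟩ := hs (v 2) (f (v 2) (v 3))
  have := hy.1
  have y1 : y ≠ v 1 := by
    rintro rfl
    exact hy.ne pu1 u2 n12 (by grind)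
  have y3 : y ≠ v 3 := by grind
  have y4 : y ≠ v 4 := by
    rintro rfl
    exact h.arrow_ne _ _ hy (by grind)
  have py : p y ≠ p u := by grind
  have := hC y (v 2) (v 3) u hy.1.symm a2.1 hu (Ne.symm py) y3 u2.symm
  have := hy.ne py (by grind) u2
  have := a2.ne py (by grind) u2
  have := hκ y u py
  have := hy.ne hu (by grind) u2
  grind

theorem not_saturated_of_last (h : Chain p f d v) (hf : ∀ u v, f u v = f v u)
    (hC : NoRainbowC4 p f) (hs : ∀ v κ, ∃ w, Arrow p f v w ∧ f v w ≠ κ)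
    (hκ : TripleSaturated p f (v 2) (v 3) (v 4) κ)
    (h1 : κ ≠ f (v 1) (v 2)) (h2 : κ ≠ f (v 2) (v 3)) (h3 : κ ≠ f (v 3) (v 4))
    (h4 : κ ≠ f (v 4) (v 5)) (hd : κ ≠ d)
    (hu : p (v 4) ≠ p u) : f (v 4) u ≠ κ := by
  intro he
  have hmid := fun w => h.not_saturated_of_middle (u := w) hf hC hs hκ h1 h2 h3 hd
  have a2 := h.arrow 2
  have a3 := h.arrow 3
  have a4 := h.arrow 4
  have a5 := h.arrow 5
  have c2 := h.chord 2
  have c4 := h.chord 4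
  have p3 := h.part 3
  have n24 := h.ne 2 4 (by simp) (by simp)
  have n23 := h.ne 2 3 (by simp) (by simp)
  have n34 := h.ne 3 4 (by simp) (by simp)
  have n45 := h.ne 4 5 (by simp) (by simp)
  have n46 := h.ne 4 6 (by simp) (by simp)
  have n26 := h.ne 2 6 (by simp) (by simp)
  have n36 := h.ne 3 6 (by simp) (by simp)
  have n56 := h.ne 5 6 (by simp) (by simp)
  simp only [Nat.reduceAdd] at *
  have u2 : u ≠ v 2 := by grind
  have u3 : u ≠ v 3 := by grind
  have u4 : u ≠ v 4 := by grind
  have u5 : u ≠ v 5 := by grind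
  have u6 : u ≠ v 6 := by grind
  have pu : p u = p (v 6) := by
    by_contra hp
    have := hC u (v 4) (v 5) (v 6) hu.symm a4.1 a5.1 (Ne.symm hp) u5 n46
    have := a4.ne hp u4 n46.symm
    have := a5.ne hp u5 n56.symm
    have := a5.ne hu (by grind) u5
    have := a4.ne a5.1 (by grind) (by grind)
    have := hκ u (v 6) hp
    grind
  have pu2 : p u ≠ p (v 2) := by have := a2.1; grind
  have fu2 : f u (v 2) = κ ∨ f u (v 2) = f (v 2) (v 3) := by
    have := hC u (v 4) (v 3) (v 2) hu.symm a3.1.symm a2.1.symm (Ne.symm pu2) u3 n24.symm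
    have := a3.ne pu2 u3 n23
    have := a2.ne a3.1 n23.symm n24.symm
    grind
  rcases fu2 with fu2 | fu2
  · obtain ⟨w, hw, hwne⟩ := hs u κ
    have := hw.1
    have w2 : w ≠ v 2 := by grind
    have w3 : w ≠ v 3 := by grind
    have w4 : w ≠ v 4 := by grind
    have pw : p (v 3) ≠ p w := by grind
    have := hC w u (v 2) (v 3) hw.1.symm pu2 a2.1 pw w2 u3
    have := hw.ne pw u3.symm (by grind)
    have := a2.ne pw n23.symm w2
    have := hw.ne a2.1 u2.symm u3.symm
    have := hmid w pw
    grind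
  · obtain ⟨y, hy, hyne⟩ := hs (v 3) (f (v 3) (v 4))
    have := hy.1
    have y2 : y ≠ v 2 := by
      rintro rfl
      exact hy.ne pu2 u3 n23 (by grind)
    have y4 : y ≠ v 4 := by grind
    have py : p y ≠ p u := by grind
    have := hC y (v 3) (v 4) u hy.1.symm a3.1 hu (Ne.symm py) y4 u3.symm
    have := hy.ne py (by grind) u3
    have := a3.ne py (by grind) u3
    have := hκ y u py
    have := hy.ne hu (by grind) u3
    grind

theorem not_saturated_of_first (h : Chain p f d v) (hf : ∀ u v, f u v = f v u)
    (hC : NoRainbowC4 p f) (hs : ∀ v κ, ∃ w, Arrow p f v w ∧ f v w ≠ κ)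
    (hκ : TripleSaturated p f (v 2) (v 3) (v 4) κ)
    (h1 : κ ≠ f (v 1) (v 2)) (h2 : κ ≠ f (v 2) (v 3)) (h3 : κ ≠ f (v 3) (v 4))
    (h4 : κ ≠ f (v 4) (v 5)) (hd : κ ≠ d)
    (hu : p (v 2) ≠ p u) : f (v 2) u ≠ κ := by
  intro he
  have hlast := h.not_saturated_of_last (u := u) hf hC hs hκ h1 h2 h3 h4 hd
  have a0 := h.arrow 0
  have a1 := h.arrow 1
  have a2 := h.arrow 2
  have a3 := h.arrow 3
  have c1 := h.chord 1
  have c0 := h.chord 0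
  have c2 := h.chord 2
  have p0 := h.part 0
  have p1 := h.part 1
  have n01 := h.ne 0 1 (by simp) (by simp)
  have n02 := h.ne 0 2 (by simp) (by simp)
  have n03 := h.ne 0 3 (by simp) (by simp)
  have n04 := h.ne 0 4 (by simp) (by simp)
  have n12 := h.ne 1 2 (by simp) (by simp)
  have n24 := h.ne 2 4 (by simp) (by simp)
  have n23 := h.ne 2 3 (by simp) (by simp)
  have n34 := h.ne 3 4 (by simp) (by simp)
  simp only [Nat.reduceAdd, zero_add] at *
  have u0 : u ≠ v 0 := by grind
  have u1 : u ≠ v 1 := by grind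
  have u2 : u ≠ v 2 := by grind
  have u3 : u ≠ v 3 := by grind
  have u4 : u ≠ v 4 := by grind
  by_cases pu : p (v 4) = p u
  · have pu0 : p u ≠ p (v 0) := by have := a0.1; grind
    have fu0 : f u (v 0) = f (v 0) (v 1) := by
      have := hC u (v 2) (v 1) (v 0) hu.symm a1.1.symm a0.1.symm (Ne.symm pu0) u1 n02.symm
      have := a1.ne pu0 u1 n01
      have := hκ u (v 0) pu0
      have := a0.ne a1.1 n01.symm n02.symm
      have := a0.ne hu n02.symm u0
      grind
    obtain ⟨y, hy, hyne⟩ := hs (v 1) (f (v 1) (v 2))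
    have := hy.1
    have y0 : y ≠ v 0 := by
      rintro rfl
      exact hy.ne pu0 u1 n01 (by grind)
    have y2 : y ≠ v 2 := by grind
    have y3 : y ≠ v 3 := by
      rintro rfl
      exact h.arrow_ne _ _ hy c1
    have y4 : y ≠ v 4 := by grind
    have py : p y ≠ p u := by grind
    have := hC y (v 1) (v 2) u hy.1.symm a1.1 hu (Ne.symm py) y2 u1.symm
    have := hy.ne py (by grind) u1
    have := a1.ne py (by grind) u1
    have := hκ y u py
    have := hy.ne hu n12.symm u1
    grind
  · have := hC u (v 2) (v 3) (v 4) hu.symm a2.1 a3.1 pu u3 n24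
    have := a2.ne pu n24.symm u2
    have := a3.ne pu n34.symm u3
    have := a3.ne hu n23 u3
    have := a2.ne a3.1 n23.symm n24.symm
    have := hlast pu
    grind

theorem saturated (h : Chain p f d v) (hf : ∀ u v, f u v = f v u)
    (hC : NoRainbowC4 p f) (hs : ∀ v κ, ∃ w, Arrow p f v w ∧ f v w ≠ κ) {x y : V}
    (hκ : TripleSaturated p f (v 2) (v 3) (v 4) (f x y)) (hxy : p x ≠ p y) :
    f x y = f (v 1) (v 2) ∨ f x y = f (v 2) (v 3) ∨ f x y = f (v 3) (v 4) ∨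
      f x y = f (v 4) (v 5) := by
  by_contra! hne
  obtain ⟨h1, h2, h3, h4⟩ := hne
  have hd : f x y ≠ d := by
    intro hd
    have c := h.chord 5
    have a5 := (h.arrow 5).1
    have a6 := (h.arrow 6).1
    have p4 := h.part 4
    have p5 := h.part 5
    have a7 := (h.arrow 7).1
    have := hκ (v 5) (v 7) (by grind) (by grind)
    have := h.ne 2 7
    have := h.ne 3 7
    have := h.ne 4 7
    have := h.ne 2 5
    have := h.ne 3 5
    have := h.ne 4 5
    grind
  have hT := hκ x y hxy rfl
  wlog hx : x = v 2 ∨ x = v 3 ∨ x = v 4 generalizing x y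
  · rw [hf x y] at *
    exact this hκ hxy.symm h1 h2 h3 h4 hd (by tauto) (by tauto)
  rcases hx with rfl | rfl | rfl
  · exact h.not_saturated_of_first hf hC hs hκ h1 h2 h3 h4 hd hxy rfl
  · exact h.not_saturated_of_middle hf hC hs hκ h1 h2 h3 hd hxy rfl
  · exact h.not_saturated_of_last hf hC hs hκ h1 h2 h3 h4 hd hxy rfl

end Chain

/-- An `ℓ`-periodic enumeration of a directed cycle of length `ℓ ≥ 3`. -/
structure DirectedCycle (p : V → ι) (f : V → V → α) (ℓ : ℕ) (v : ℕ → V) : Prop where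
  three_le : 3 ≤ ℓ
  arrow : ∀ i, Arrow p f (v i) (v (i + 1))
  periodic : ∀ i, v (i + ℓ) = v i
  ne : ∀ i j, i < j → j < i + ℓ → v i ≠ v j

theorem DirectedCycle.of_closed_path {ℓ : ℕ} {w : ℕ → V} (hℓ : 3 ≤ ℓ)
    (h : ∀ i, i + 1 < ℓ → Arrow p f (w i) (w (i + 1))) (hlast : Arrow p f (w (ℓ - 1)) (w 0))
    (hinj : ∀ i j, i < j → j < ℓ → w i ≠ w j) :
    DirectedCycle p f ℓ fun i => w (i % ℓ) where
  three_le := hℓ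
  arrow i := by
    have hi := Nat.mod_lt i (show 0 < ℓ by omega)
    rw [Nat.add_mod, Nat.mod_eq_of_lt (show 1 < ℓ by omega)]
    rcases Nat.lt_or_ge (i % ℓ + 1) ℓ with h' | h'
    · rw [Nat.mod_eq_of_lt h']
      exact h _ h'
    · rw [show i % ℓ + 1 = ℓ by omega, Nat.mod_self, show i % ℓ = ℓ - 1 by omega]
      exact hlast
  periodic i := by simp
  ne i j hij hj := by
    have hi' := Nat.mod_lt i (show 0 < ℓ by omega)
    have hj' := Nat.mod_lt j (show 0 < ℓ by omega)
    have hne : i % ℓ ≠ j % ℓ := by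
      intro he
      have := (Nat.modEq_iff_dvd' hij.le).1 he
      exact absurd (Nat.le_of_dvd (by omega) this) (by omega)
    rcases Nat.lt_or_gt_of_ne hne with h' | h'
    · exact hinj _ _ h' hj'
    · exact (hinj _ _ h' hi').symm

theorem exists_directedCycle [Finite V] [Nonempty V]
    (hs : ∀ v κ, ∃ w, Arrow p f v w ∧ f v w ≠ κ) : ∃ ℓ v, DirectedCycle p f ℓ v := by
  classical
  choose g hg hgne using hs
  let a : V := Classical.arbitrary V
  let step : V × V → V × V := fun q => (q.2, g q.2 (f q.2 q.1))
  let s : ℕ → V × V := fun i => step^[i] (a, g a (f a a))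
  have hstep : ∀ i, s (i + 1) = step (s i) := fun i => Function.iterate_succ_apply' _ _ _
  let w : ℕ → V := fun i => (s i).1
  have harrow : ∀ i, Arrow p f (w i) (w (i + 1)) := by
    intro i
    have h1 : w (i + 1) = (s i).2 := by simp only [w, hstep, step]
    rw [h1]
    cases i with
    | zero => exact hg _ _
    | succ i =>
      simp only [w, hstep, step]
      exact hg _ _
  have hback : ∀ i, w (i + 2) ≠ w i := by
    intro i he
    have h2 : w (i + 2) = g (s i).2 (f (s i).2 (s i).1) := by
      simp only [w, hstep, step]
    have := hgne (s i).2 (f (s i).2 (s i).1)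
    rw [← h2, he] at this
    exact this rfl
  have hrep : ∃ j, ∃ i < j, w i = w j := by
    obtain ⟨i, j, hne, he⟩ := Finite.exists_ne_map_eq_of_infinite w
    rcases Nat.lt_or_gt_of_ne hne with h | h
    · exact ⟨j, i, h, he⟩
    · exact ⟨i, j, h, he.symm⟩
  obtain ⟨i, hij, he⟩ := Nat.find_spec hrep
  have hmin := fun m (h : m < Nat.find hrep) => Nat.find_min hrep h
  generalize Nat.find hrep = j at *
  have hj : i + 3 ≤ j := by
    by_contra hlt
    obtain rfl | rfl : j = i + 1 ∨ j = i + 2 := by omega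
    · exact (harrow i).1 (congrArg p he)
    · exact hback i he.symm
  refine ⟨j - i, _, DirectedCycle.of_closed_path (w := fun k => w (i + k)) (by omega)
    (fun k _ => harrow _) ?_ ?_⟩
  · have := harrow (i + (j - i - 1))
    rw [show i + (j - i - 1) + 1 = j by omega, ← he] at this
    exact this
  · intro k l hkl hl h
    exact hmin (i + l) (by omega) ⟨i + k, by omega, h⟩

namespace DirectedCycle

variable {ℓ : ℕ} {v : ℕ → V}

theorem shift (h : DirectedCycle p f ℓ v) (k : ℕ) : DirectedCycle p f ℓ fun i => v (k + i) where
  three_le := h.three_le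
  arrow i := h.arrow (k + i)
  periodic i := by simpa only [Nat.add_assoc] using h.periodic (k + i)
  ne i j hij hj := h.ne _ _ (by omega) (by omega)

theorem shortcut (h : DirectedCycle p f ℓ v) {j : ℕ} (hj : 1 ≤ j) (hjℓ : j + 2 ≤ ℓ)
    (ha : Arrow p f (v 0) (v j)) : ∃ w, DirectedCycle p f (ℓ + 1 - j) w := by
  refine ⟨_, of_closed_path (w := fun i => if i = 0 then v 0 else v (j - 1 + i)) (by omega)
    ?_ ?_ ?_⟩
  · intro i hi
    rcases Nat.eq_zero_or_pos i with rfl | h0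
    · simpa [show j - 1 + 1 = j by omega] using ha
    · simpa [h0.ne', Nat.add_assoc] using h.arrow (j - 1 + i)
  · have := h.arrow (ℓ - 1)
    rw [show ℓ - 1 + 1 = 0 + ℓ by omega, h.periodic] at this
    simpa [show ¬ ℓ ≤ j by omega, show ℓ + 1 - j - 1 ≠ 0 by omega,
      show j - 1 + (ℓ + 1 - j - 1) = ℓ - 1 by omega] using this
  · intro i k hik hk
    rcases Nat.eq_zero_or_pos i with rfl | h0
    · simpa [hik.ne'] using h.ne 0 (j - 1 + k) (by omega) (by omega)
    · simpa [h0.ne', (h0.trans hik).ne'] using h.ne (j - 1 + i) (j - 1 + k) (by omega) (by omega)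

theorem ne_four (h : DirectedCycle p f ℓ v) (hC : NoRainbowC4 p f) : ℓ ≠ 4 := by
  rintro rfl
  have p0 := h.periodic 0
  have a0 := h.arrow 0
  have a1 := h.arrow 1
  have a2 := h.arrow 2
  have a3 := h.arrow 3
  have n01 := h.ne 0 1 (by simp) (by simp)
  have n02 := h.ne 0 2 (by simp) (by simp)
  have n03 := h.ne 0 3 (by simp) (by simp)
  have n12 := h.ne 1 2 (by simp) (by simp)
  have n13 := h.ne 1 3 (by simp) (by simp)
  have n23 := h.ne 2 3 (by simp) (by simp)
  simp only [Nat.reduceAdd, zero_add] at *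
  rw [p0] at a3
  have := hC _ _ _ _ a0.1 a1.1 a2.1 a3.1 n02 n13
  have := a0.ne a1.1 n01.symm n02.symm
  have := a0.ne a2.1 n02.symm n03.symm
  have := a1.ne a2.1 n12.symm n13.symm
  have := a1.ne a3.1 n13.symm n01
  have := a2.ne a3.1 n23.symm n02
  have := a3.ne a0.1 n03 n13
  grind

theorem arrow_three (h : DirectedCycle p f ℓ v) (hf : ∀ u v, f u v = f v u)
    (hC : NoRainbowC4 p f) (hℓ : 4 ≤ ℓ) (hp : p (v 0) ≠ p (v 3)) : Arrow p f (v 0) (v 3) := by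
  have a0 := h.arrow 0
  have a1 := h.arrow 1
  have a2 := h.arrow 2
  have n01 := h.ne 0 1 (by omega) (by omega)
  have n02 := h.ne 0 2 (by omega) (by omega)
  have n12 := h.ne 1 2 (by omega) (by omega)
  have n13 := h.ne 1 3 (by omega) (by omega)
  have n03 := h.ne 0 3 (by omega) (by omega)
  have n23 := h.ne 2 3 (by omega) (by omega)
  simp only [Nat.reduceAdd, zero_add] at *
  have he : f (v 0) (v 3) = f (v 0) (v 1) := by
    have := hC _ _ _ _ a0.1 a1.1 a2.1 hp.symm n02 n13
    have := a0.ne a1.1 n01.symm n02.symm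
    have := a0.ne a2.1 n02.symm n03.symm
    have := a1.ne a2.1 n12.symm n13.symm
    have := a1.ne hp n01 n13.symm
    have := a2.ne hp n02 n23.symm
    grind
  exact ⟨hp, he ▸ a0.2⟩

theorem exists_chain (h : DirectedCycle p f ℓ v) (hf : ∀ u v, f u v = f v u)
    (hC : NoRainbowC4 p f) (hmin : ∀ k w, DirectedCycle p f k w → ℓ ≤ k) (hℓ : ℓ ≠ 3) :
    ∃ d, Chain p f d v := by
  have h3 := h.three_le
  have h4 := h.ne_four hC
  have hpart : ∀ i, p (v i) = p (v (i + 3)) := by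
    intro i
    by_contra hp
    obtain ⟨w, hw⟩ := (h.shift i).shortcut (j := 3) (by simp) (by omega)
      ((h.shift i).arrow_three hf hC (by omega) hp)
    have := hmin _ _ hw
    omega
  have h5 : ℓ ≠ 5 := by
    rintro rfl
    have e1 := hpart 0
    have e2 := hpart 3
    have e3 := h.periodic 1
    have := (h.arrow 0).1
    simp only [Nat.reduceAdd, zero_add] at *
    grind
  have hadj : ∀ i, p (v i) ≠ p (v (i + 2)) := by
    intro i he
    exact (h.arrow (i + 2)).1 (he.symm.trans (hpart i))
  have hskip : ∀ i, ¬ Arrow p f (v i) (v (i + 2)) := by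
    intro i ha
    obtain ⟨w, hw⟩ := (h.shift i).shortcut (j := 2) (by simp) (by omega) ha
    have := hmin _ _ hw
    omega
  have hback : ∀ i, ¬ Arrow p f (v (i + 2)) (v i) := by
    intro i ha
    have := hmin _ _ (of_closed_path (w := fun k => v (i + k)) (le_refl 3)
      (fun k _ => h.arrow _) ha (fun k l hkl hl => h.ne _ _ (by omega) (by omega)))
    omega
  have hsucc : ∀ i, f (v i) (v (i + 2)) = f (v (i + 1)) (v (i + 3)) := by
    intro i
    have a0 := h.arrow i
    have a2 := h.arrow (i + 2)
    have c0 := hadj i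
    have c1 := hadj (i + 1)
    have n01 := h.ne i (i + 1) (by omega) (by omega)
    have n02 := h.ne i (i + 2) (by omega) (by omega)
    have n03 := h.ne i (i + 3) (by omega) (by omega)
    have n12 := h.ne (i + 1) (i + 2) (by omega) (by omega)
    have n23 := h.ne (i + 2) (i + 3) (by omega) (by omega)
    have s0 : f (v i) (v (i + 2)) ≠ f (v i) (v (i + 1)) :=
      fun he => hskip i ⟨c0, he ▸ a0.2⟩
    have s2 : f (v i) (v (i + 2)) ≠ f (v (i + 2)) (v (i + 3)) :=
      fun he => hback i ⟨c0.symm, by rw [hf, he]; exact a2.2⟩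
    have := hC (v i) (v (i + 2)) (v (i + 3)) (v (i + 1)) c0 a2.1 c1.symm a0.1.symm n03 n12.symm
    have := a2.ne c1 n12 n23.symm
    have := a0.ne c1 n01.symm n03.symm
    have := a0.ne a2.1 n02.symm n03.symm
    grind
  have hconst : ∀ i, f (v i) (v (i + 2)) = f (v 0) (v 2) := by
    intro i
    induction i with
    | zero => rfl
    | succ i ih => rw [← ih, hsucc i]
  refine ⟨f (v 0) (v 2), h.arrow, hpart, hconst, fun i j hij hj => h.ne i j hij (by omega), ?_⟩
  intro x y hxy he
  have := hxy.2 _ _ (hadj 0) he.symm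
  have := hxy.2 _ _ (hadj 1) ((hconst 1).trans he.symm)
  have := h.ne 0 1 (by omega) (by omega)
  have := h.ne 0 3 (by omega) (by omega)
  have := h.ne 1 2 (by omega) (by omega)
  have := h.ne 2 3 (by omega) (by omega)
  grind

end DirectedCycle

/-- If every vertex sees two colours that appear only at that vertex, then some triangle has at
most four colours that appear only on edges meeting it. -/
theorem exists_triangle_few_saturated [Finite V] [Nonempty V] (hf : ∀ u v, f u v = f v u)
    (hC : NoRainbowC4 p f) (hs : ∀ v κ, ∃ w, Arrow p f v w ∧ f v w ≠ κ) :
    ∃ x y z, p x ≠ p y ∧ p y ≠ p z ∧ p z ≠ p x ∧ ∃ a b c d, ∀ s t, p s ≠ p t →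
      TripleSaturated p f x y z (f s t) → f s t = a ∨ f s t = b ∨ f s t = c ∨ f s t = d := by
  classical
  have hex := exists_directedCycle hs
  obtain ⟨v, hv⟩ := Nat.find_spec hex
  have hmin : ∀ k w, DirectedCycle p f k w → Nat.find hex ≤ k :=
    fun k w hw => Nat.find_min' hex ⟨w, hw⟩
  generalize Nat.find hex = ℓ at *
  by_cases hℓ : ℓ = 3
  · subst hℓ
    have a0 := hv.arrow 0
    have a1 := hv.arrow 1
    have a2 := hv.arrow 2
    have p0 := hv.periodic 0
    simp only [Nat.reduceAdd, zero_add] at *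
    rw [p0] at a2
    refine ⟨v 0, v 1, v 2, a0.1, a1.1, a2.1, ?_⟩
    by_cases hκ : ∃ s t, p s ≠ p t ∧ TripleSaturated p f (v 0) (v 1) (v 2) (f s t) ∧
      f s t ≠ f (v 0) (v 1) ∧ f s t ≠ f (v 1) (v 2) ∧ f s t ≠ f (v 2) (v 0)
    · obtain ⟨s, t, hst, hT, h1, h2, h3⟩ := hκ
      refine ⟨f (v 0) (v 1), f (v 1) (v 2), f (v 2) (v 0), f s t, fun s' t' hst' hT' => ?_⟩
      by_contra! hne
      exact hne.2.2.2 (directed_triangle_saturated_unique hf hC hs a0 a1 a2 hT' hT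
        hne.1 hne.2.1 hne.2.2.1 h1 h2 h3 hst' hst)
    · push Not at hκ
      refine ⟨f (v 0) (v 1), f (v 1) (v 2), f (v 2) (v 0), f (v 2) (v 0), fun s t hst hT => ?_⟩
      have := hκ s t hst hT
      tauto
  · obtain ⟨d, hd⟩ := hv.exists_chain hf hC hmin hℓ
    have p1 := hd.part 1
    have a3 := (hd.arrow 3).1
    have a4 := (hd.arrow 4).1
    have p2 := hd.part 2
    refine ⟨v 2, v 3, v 4, (hd.arrow 2).1, a3, by grind, _, _, _, _,
      fun s t hst hT => hd.saturated hf hC hs hT hst⟩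

end LocalStructure

section Counting

variable {V ι α : Type*} [DecidableEq ι] [DecidableEq α]

/-- The colours of the edges inside `S`. -/
def edgeColors (p : V → ι) (f : V → V → α) (S : Finset V) : Finset α :=
  ((S ×ˢ S).filter fun e => p e.1 ≠ p e.2).image fun e => f e.1 e.2

/-- Three counting conditions satisfied by `S` if it contains `m` disjoint triangles. -/
def RoomForTriangles (p : V → ι) (S : Finset V) (m : ℕ) : Prop :=
  3 * m ≤ #S ∧ (∀ i, 2 * m ≤ #{v ∈ S | p v ≠ i}) ∧ ∀ i j, m ≤ #{v ∈ S | p v ≠ i ∧ p v ≠ j}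

variable {p : V → ι} {f : V → V → α} {S : Finset V}

theorem mem_edgeColors {κ : α} :
    κ ∈ edgeColors p f S ↔ ∃ x ∈ S, ∃ y ∈ S, p x ≠ p y ∧ f x y = κ := by
  simp only [edgeColors, mem_image, mem_filter, mem_product, Prod.exists]
  grind

theorem RoomForTriangles.mono {T : Finset V} {m : ℕ} (h : RoomForTriangles p S m) (hST : S ⊆ T) :
    RoomForTriangles p T m :=
  ⟨h.1.trans (card_le_card hST), fun i => (h.2.1 i).trans (card_le_card (filter_subset_filter _ hST)),
    fun i j => (h.2.2 i j).trans (card_le_card (filter_subset_filter _ hST))⟩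

variable [DecidableEq V]

theorem RoomForTriangles.union_triangle {m : ℕ} {x y z : V} (h : RoomForTriangles p (S \ {x, y, z}) m)
    (hx : x ∈ S) (hy : y ∈ S) (hz : z ∈ S) (hxy : p x ≠ p y) (hyz : p y ≠ p z) (hzx : p z ≠ p x) :
    RoomForTriangles p S (m + 1) := by
  have hR : ({x, y, z} : Finset V) ⊆ S := by grind
  have h3 : #({x, y, z} : Finset V) = 3 := card_eq_three.2 ⟨x, y, z, by grind, by grind, by grind, rfl⟩
  have hsplit : ∀ q : V → Prop, ∀ [DecidablePred q],
      #{v ∈ S | q v} = #{v ∈ S \ {x, y, z} | q v} + #{v ∈ ({x, y, z} : Finset V) | q v} := by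
    intro q _
    rw [← card_union_of_disjoint (disjoint_filter_filter sdiff_disjoint), ← filter_union,
      sdiff_union_of_subset hR]
  refine ⟨?_, fun i => ?_, fun i j => ?_⟩
  · have := card_sdiff_add_card_eq_card hR
    have := h.1
    omega
  · have h2 : 2 ≤ #{v ∈ ({x, y, z} : Finset V) | p v ≠ i} := by
      by_cases hi : p x = i
      · exact (card_pair (show y ≠ z by grind)).ge.trans (card_le_card (by grind))
      · by_cases hi' : p y = i
        · exact (card_pair (show x ≠ z by grind)).ge.trans (card_le_card (by grind))
        · exact (card_pair (show x ≠ y by grind)).ge.trans (card_le_card (by grind))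
    have := h.2.1 i
    rw [hsplit]
    omega
  · have h1 : 1 ≤ #{v ∈ ({x, y, z} : Finset V) | p v ≠ i ∧ p v ≠ j} := by
      rw [Nat.one_le_iff_ne_zero, card_ne_zero]
      by_cases hi : p x ≠ i ∧ p x ≠ j
      · exact ⟨x, by grind⟩
      · by_cases hi' : p y ≠ i ∧ p y ≠ j
        · exact ⟨y, by grind⟩
        · exact ⟨z, by grind⟩
    have := h.2.2 i j
    rw [hsplit]
    omega

theorem card_edgeColors_triangle_le (hf : ∀ u v, f u v = f v u) (x y z : V) :
    #(edgeColors p f {x, y, z}) ≤ 3 := by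
  have : edgeColors p f {x, y, z} ⊆ {f x y, f y z, f z x} := by
    intro κ hκ
    obtain ⟨u, hu, v, hv, huv, rfl⟩ := mem_edgeColors.1 hκ
    simp only [mem_insert, mem_singleton] at *
    grind
  exact (card_le_card this).trans card_le_three

theorem exists_arrow_of_one_lt_card {v : V} (hf : ∀ u v, f u v = f v u) (hv : v ∈ S)
    (h : 1 < #(edgeColors p f S \ edgeColors p f (S.erase v))) (κ : α) :
    ∃ w : S, Arrow (fun u : S => p u) (fun u w : S => f u w) ⟨v, hv⟩ w ∧ f v w ≠ κ := by
  obtain ⟨μ, hμ, hne⟩ := exists_mem_ne h κ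
  rw [mem_sdiff, mem_edgeColors, mem_edgeColors] at hμ
  obtain ⟨⟨x, hx, y, hy, hxy, rfl⟩, hno⟩ := hμ
  have hsat : ∀ s t : S, p s ≠ p t → f s t = f x y → s = ⟨v, hv⟩ ∨ t = ⟨v, hv⟩ := by
    rintro ⟨s, hs⟩ ⟨t, ht⟩ hst he
    by_contra! hst'
    exact hno ⟨s, by grind, t, by grind, hst, he⟩
  rcases hsat ⟨x, hx⟩ ⟨y, hy⟩ hxy rfl with h | h
  · obtain rfl : x = v := congrArg Subtype.val h
    exact ⟨⟨y, hy⟩, ⟨hxy, hsat⟩, hne⟩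
  · obtain rfl : y = v := congrArg Subtype.val h
    exact ⟨⟨x, hx⟩, ⟨hxy.symm, fun s t hst he => hsat s t hst (he.trans (hf _ _))⟩, by rwa [hf]⟩

theorem exists_card_edgeColors_lt (hf : ∀ u v, f u v = f v u) (hC : NoRainbowC4 p f)
    (hS : S.Nonempty) : ∃ m, RoomForTriangles p S m ∧ #(edgeColors p f S) < #S + m := by
  induction S using Finset.strongInduction with
  | H S ih =>
  by_cases hv : ∃ v ∈ S, #(edgeColors p f S \ edgeColors p f (S.erase v)) ≤ 1
  · obtain ⟨v, hv, h1⟩ := hv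
    rcases (S.erase v).eq_empty_or_nonempty with h0 | h0
    · have : edgeColors p f S = ∅ := by
        rw [eq_empty_iff_forall_notMem]
        intro κ hκ
        obtain ⟨x, hx, y, hy, hxy, -⟩ := mem_edgeColors.1 hκ
        have : ∀ u ∈ S, u = v := by
          intro u hu
          by_contra hne
          exact notMem_empty u (h0 ▸ mem_erase.2 ⟨hne, hu⟩)
        exact hxy (by rw [this x hx, this y hy])
      exact ⟨0, by simp [RoomForTriangles], by simpa [this] using hS⟩
    · obtain ⟨m, hm, hlt⟩ := ih _ (erase_ssubset hv) h0
      refine ⟨m, hm.mono (erase_subset _ _), ?_⟩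
      have := card_erase_add_one hv
      have := card_le_card_sdiff_add_card (s := edgeColors p f S) (t := edgeColors p f (S.erase v))
      omega
  · push Not at hv
    have : Nonempty S := hS.to_subtype
    obtain ⟨⟨x, hx⟩, ⟨y, hy⟩, ⟨z, hz⟩, hxy, hyz, hzx, a, b, c, d, hT⟩ :=
      exists_triangle_few_saturated (p := fun u : S => p u) (f := fun u w : S => f u w)
        (fun u w => hf u w)
        (fun s t u w h1 h2 h3 h4 h5 h6 => hC s t u w h1 h2 h3 h4
          (Subtype.coe_injective.ne h5) (Subtype.coe_injective.ne h6))
        (fun v κ => exists_arrow_of_one_lt_card hf v.2 (hv v v.2) κ)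
    dsimp only at hxy hyz hzx
    have hR : ({x, y, z} : Finset V) ⊆ S := by grind
    have h3 : #({x, y, z} : Finset V) = 3 :=
      card_eq_three.2 ⟨x, y, z, by grind, by grind, by grind, rfl⟩
    have hcard := card_sdiff_add_card_eq_card hR
    rcases (S \ {x, y, z}).eq_empty_or_nonempty with h0 | h0
    · have hroom : RoomForTriangles p (S \ {x, y, z}) 0 := by simp [RoomForTriangles]
      refine ⟨1, hroom.union_triangle hx hy hz hxy hyz hzx, ?_⟩
      have := card_edgeColors_triangle_le (p := p) hf x y z
      rw [← subset_antisymm (sdiff_eq_empty_iff_subset.1 h0) hR] at this h3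
      omega
    · obtain ⟨m, hm, hlt⟩ := ih _ (sdiff_ssubset hR (by simp)) h0
      refine ⟨m + 1, hm.union_triangle hx hy hz hxy hyz hzx, ?_⟩
      have hsub : edgeColors p f S ⊆ edgeColors p f (S \ {x, y, z}) ∪ {a, b, c, d} := by
        intro κ hκ
        rw [mem_union]
        by_contra! hne
        obtain ⟨s, hs, t, ht, hst, rfl⟩ := mem_edgeColors.1 hκ
        have := hT ⟨s, hs⟩ ⟨t, ht⟩ hst (by
          rintro ⟨u, hu⟩ ⟨w, hw⟩ huw he
          by_contra! hnot
          simp only [ne_eq, Subtype.mk.injEq] at hnot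
          exact hne.1 (mem_edgeColors.2 ⟨u, by grind, w, by grind, huw, he⟩))
        simp only [mem_insert, mem_singleton] at hne
        tauto
      have := (card_le_card hsub).trans (card_union_le _ _)
      have := card_le_four (a := a) (b := b) (c := c) (d := d)
      omega

end Counting

section Construction

variable {V ι : Type*} {p : V → ι} {ρ τ : V → ℕ}

/-- The colouring of a vertex set split into pieces, `ρ` giving the piece of a vertex and `τ` its
place therein: an edge between two pieces gets the colour of the earlier piece, and edges inside a
piece get private colours. -/
def pieceColoring (ρ τ : V → ℕ) (u v : V) : ℕ ⊕ ℕ × ℕ :=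
  if ρ u = ρ v then Sum.inr (ρ u, τ u + τ v) else Sum.inl (min (ρ u) (ρ v))

theorem pieceColoring_symm (u v : V) : pieceColoring ρ τ u v = pieceColoring ρ τ v u := by
  unfold pieceColoring
  grind

theorem noRainbowC4_pieceColoring (hτ : ∀ v, τ v < 3)
    (hinj : ∀ u v, ρ u = ρ v → τ u = τ v → u = v) : NoRainbowC4 p (pieceColoring ρ τ) := by
  intro a b d e hab hbd hde hea had hbe
  have h1 := hinj a b
  have h2 := hinj b d
  have h3 := hinj d e
  have h4 := hinj e a
  have h5 := hinj a d
  have h6 := hinj b e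
  have ha := hτ a
  have hb := hτ b
  have hd := hτ d
  have he := hτ e
  by_cases hall : ρ a = ρ b ∧ ρ b = ρ d ∧ ρ d = ρ e
  · grind
  · by_contra! hne
    obtain ⟨q1, q2, q3, q4, q5, q6⟩ := hne
    have key : ∀ {u v u' v' : V}, pieceColoring ρ τ u v ≠ pieceColoring ρ τ u' v' →
        ρ u ≠ ρ v → ρ u' ≠ ρ v' → min (ρ u) (ρ v) ≠ min (ρ u') (ρ v') := by
      intro u v u' v' hne h h' hmin
      exact hne (by rw [pieceColoring, pieceColoring, if_neg h, if_neg h', hmin])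
    replace q1 := key q1
    replace q2 := key q2
    replace q3 := key q3
    replace q4 := key q4
    replace q5 := key q5
    replace q6 := key q6
    clear h1 h2 h3 h4 h5 h6 ha hb hd he
    omega

theorem le_card_edgeColors_pieceColoring [Fintype V] [DecidableEq ι] {M t : ℕ} (ht : 1 ≤ t)
    {g : Fin t × Fin 3 → V} (hM : ∀ j < M, ∃ v, ρ v = j) (hρ : ∀ i, ρ (g i) = M + i.1)
    (hτ : ∀ i, τ (g i) = i.2) (hg : ∀ i a b, a ≠ b → p (g (i, a)) ≠ p (g (i, b))) :
    M + 3 * t + t - 1 ≤ #(edgeColors p (pieceColoring ρ τ) univ) := by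
  have hsub : (range (M + t - 1)).disjSum ((Ico M (M + t)) ×ˢ (Ico 1 4)) ⊆
      edgeColors p (pieceColoring ρ τ) univ := by
    intro κ hκ
    rw [mem_edgeColors]
    rcases mem_disjSum.1 hκ with ⟨j, hj, rfl⟩ | ⟨⟨i, s⟩, his, rfl⟩
    · rw [mem_range] at hj
      obtain ⟨u, hu⟩ : ∃ u, ρ u = j := by
        by_cases hjM : j < M
        · exact hM j hjM
        · exact ⟨g (⟨j - M, by omega⟩, 0), by rw [hρ]; simp only; omega⟩
      have hlast : ∀ a, ρ (g (⟨t - 1, by omega⟩, a)) = M + t - 1 := by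
        intro a
        rw [hρ]
        simp only
        omega
      obtain ⟨a, ha⟩ : ∃ a, p u ≠ p (g (⟨t - 1, by omega⟩, a)) := by
        by_contra! hcon
        exact hg ⟨t - 1, by omega⟩ 0 1 (by decide) ((hcon 0).symm.trans (hcon 1))
      refine ⟨u, mem_univ _, _, mem_univ _, ha, ?_⟩
      rw [pieceColoring, hlast, hu, if_neg (by omega), min_eq_left (by omega)]
    · simp only [mem_product, mem_Ico] at his
      obtain ⟨⟨hi, hi'⟩, hs, hs'⟩ := his
      obtain ⟨a, b, hab, hsum⟩ : ∃ a b : Fin 3, a ≠ b ∧ (a : ℕ) + b = s := by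
        obtain rfl | rfl | rfl : s = 1 ∨ s = 2 ∨ s = 3 := by omega
        · exact ⟨0, 1, by decide, rfl⟩
        · exact ⟨0, 2, by decide, rfl⟩
        · exact ⟨1, 2, by decide, rfl⟩
      refine ⟨g (⟨i - M, by omega⟩, a), mem_univ _, g (⟨i - M, by omega⟩, b), mem_univ _,
        hg _ _ _ hab, ?_⟩
      rw [pieceColoring, hρ, hρ, hτ, hτ, if_pos rfl]
      simp only [Sum.inr.injEq, Prod.mk.injEq]
      omega
  have := card_le_card hsub
  simp only [card_disjSum, card_range, card_product, Nat.card_Ico] at this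
  omega

/-- Any family of `t ≥ 1` disjoint triangles yields a colouring with `|V| + t - 1` colours. -/
theorem exists_coloring_of_triangles [Fintype V] [DecidableEq ι] {t : ℕ} (ht : 1 ≤ t)
    {g : Fin t × Fin 3 → V} (hinj : Function.Injective g)
    (hg : ∀ i a b, a ≠ b → p (g (i, a)) ≠ p (g (i, b))) :
    ∃ f : V → V → ℕ ⊕ ℕ × ℕ, (∀ u v, f u v = f v u) ∧ NoRainbowC4 p f ∧
      Fintype.card V + t - 1 ≤ #(edgeColors p f univ) := by
  classical
  let R : Finset V := univ.image g
  have hR : #R = 3 * t := by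
    rw [card_image_of_injective _ hinj]
    simp [mul_comm]
  have hcard : #Rᶜ + 3 * t = Fintype.card V := by
    rw [← hR, add_comm, card_add_card_compl]
  let e := Rᶜ.equivFin
  have hmem : ∀ v, v ∉ Rᶜ → ∃ i, g i = v := by
    intro v hv
    simpa [R] using hv
  let ρ : V → ℕ := fun v => if h : v ∈ Rᶜ then e ⟨v, h⟩ else #Rᶜ + (hmem v h).choose.1
  let τ : V → ℕ := fun v => if h : v ∈ Rᶜ then 0 else (hmem v h).choose.2
  have hgR : ∀ i, g i ∉ Rᶜ := by
    intro i
    simp [R]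
  have hchoose : ∀ i, (hmem (g i) (hgR i)).choose = i :=
    fun i => hinj (hmem (g i) (hgR i)).choose_spec
  have hρ : ∀ i, ρ (g i) = #Rᶜ + i.1 := by
    intro i
    simp only [ρ, dif_neg (hgR i), hchoose]
  have hτ : ∀ i, τ (g i) = i.2 := by
    intro i
    simp only [τ, dif_neg (hgR i), hchoose]
  have hρU : ∀ v (h : v ∈ Rᶜ), ρ v = e ⟨v, h⟩ := by
    intro v h
    simp only [ρ, dif_pos h]
  refine ⟨pieceColoring ρ τ, pieceColoring_symm, noRainbowC4_pieceColoring ?_ ?_, ?_⟩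
  · intro v
    by_cases h : v ∈ Rᶜ
    · have : τ v = 0 := by simp only [τ, dif_pos h]
      omega
    · obtain ⟨i, rfl⟩ := hmem v h
      rw [hτ]
      exact i.2.2
  · intro u v h1 h2
    by_cases hu : u ∈ Rᶜ <;> by_cases hv : v ∈ Rᶜ
    · rw [hρU u hu, hρU v hv] at h1
      exact congrArg Subtype.val (e.injective (Fin.ext h1))
    · obtain ⟨i, rfl⟩ := hmem v hv
      rw [hρU u hu, hρ] at h1
      omega
    · obtain ⟨i, rfl⟩ := hmem u hu
      rw [hρU v hv, hρ] at h1
      omega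
    · obtain ⟨i, rfl⟩ := hmem u hu
      obtain ⟨j, rfl⟩ := hmem v hv
      rw [hρ, hρ] at h1
      rw [hτ, hτ] at h2
      rw [Prod.ext (Fin.ext (by omega)) (Fin.ext h2) (x := i) (y := j)]
  · rw [← hcard]
    refine le_card_edgeColors_pieceColoring ht (fun j hj => ?_) hρ hτ hg
    refine ⟨(e.symm ⟨j, hj⟩).1, ?_⟩
    rw [hρU _ (e.symm ⟨j, hj⟩).2]
    simp

end Construction

section Parts

variable {r : ℕ} {n : ℕ → ℕ}

theorem exists_disjoint_triangles {t : ℕ} (h : 3 * t ≤ ∑ i ∈ range r, min (n i) t) :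
    ∃ g : Fin t × Fin 3 → (i : Fin r) × Fin (n i), Function.Injective g ∧
      ∀ i a b, a ≠ b → (g (i, a)).1 ≠ (g (i, b)).1 := by
  let e := finSigmaFinEquiv (n := fun i : Fin r => min (n i) t)
  have hpos : ∀ q : Fin t × Fin 3, (q.1 : ℕ) + q.2 * t < ∑ i : Fin r, min (n i) t := by
    rintro ⟨i, a⟩
    rw [Fin.sum_univ_eq_sum_range (fun i => min (n i) t)]
    have := Nat.mul_le_mul_right t (show (a : ℕ) ≤ 2 by omega)
    simp only
    omega
  have hlt : ∀ x y, x.1 = y.1 → (e x : ℕ) < e y + t := by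
    rintro ⟨i, x⟩ ⟨j, y⟩ hij
    obtain rfl : i = j := hij
    simp only [e, finSigmaFinEquiv_apply]
    omega
  refine ⟨fun q => ⟨(e.symm ⟨_, hpos q⟩).1,
    Fin.castLE (min_le_left _ _) (e.symm ⟨_, hpos q⟩).2⟩, ?_, ?_⟩
  · rintro ⟨i, a⟩ ⟨j, b⟩ hq
    have hS : e.symm ⟨_, hpos (i, a)⟩ = e.symm ⟨_, hpos (j, b)⟩ := by
      dsimp only at hq
      generalize e.symm ⟨_, hpos (i, a)⟩ = x at hq
      generalize e.symm ⟨_, hpos (j, b)⟩ = y at hq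
      obtain ⟨x1, x2⟩ := x
      obtain ⟨y1, y2⟩ := y
      simp only [Sigma.mk.injEq] at hq
      obtain ⟨rfl, hq⟩ := hq
      simpa using hq
    have := congrArg Fin.val (e.symm.injective hS)
    simp only at this
    have hab : a = b := by
      rcases lt_trichotomy a b with hab | hab | hab
      · have := Nat.mul_le_mul_right t (show (a : ℕ) + 1 ≤ b from hab)
        rw [add_mul] at this
        omega
      · exact hab
      · have := Nat.mul_le_mul_right t (show (b : ℕ) + 1 ≤ a from hab)
        rw [add_mul] at this
        omega
    subst hab
    rw [Prod.mk.injEq]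
    exact ⟨Fin.ext (by omega), rfl⟩
  · intro i a b hab he
    have h1 := hlt _ _ he
    have h2 := hlt _ _ he.symm
    simp only [Equiv.apply_symm_apply] at h1 h2
    rcases lt_or_gt_of_ne hab with hab | hab
    · have := Nat.mul_le_mul_right t (show (a : ℕ) + 1 ≤ b from hab)
      rw [add_mul] at this
      omega
    · have := Nat.mul_le_mul_right t (show (b : ℕ) + 1 ≤ a from hab)
      rw [add_mul] at this
      omega

theorem three_mul_le_sum_min (hr : 3 ≤ r) (hmono : ∀ i j : ℕ, i ≤ j → j < r → n j ≤ n i) {t : ℕ}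
    (h0 : 3 * t ≤ ∑ i ∈ range r, n i) (h1 : 2 * t ≤ ∑ i ∈ Ico 1 r, n i)
    (h2 : t ≤ ∑ i ∈ Ico 2 r, n i) : 3 * t ≤ ∑ i ∈ range r, min (n i) t := by
  have hsplit : ∀ m : ℕ → ℕ, ∑ i ∈ Ico 1 r, m i = m 1 + ∑ i ∈ Ico 2 r, m i :=
    fun m => sum_eq_sum_Ico_succ_bot (by omega) m
  have hsplit' : ∀ m : ℕ → ℕ, ∑ i ∈ range r, m i = m 0 + (m 1 + ∑ i ∈ Ico 2 r, m i) := by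
    intro m
    rw [← hsplit, range_eq_Ico]
    exact sum_eq_sum_Ico_succ_bot (by omega) m
  rw [hsplit] at h1
  rw [hsplit'] at h0 ⊢
  have m01 := hmono 0 1 (by omega) (by omega)
  have m12 := hmono 1 2 (by omega) (by omega)
  by_cases hn : n 2 ≤ t
  · have : ∑ i ∈ Ico 2 r, min (n i) t = ∑ i ∈ Ico 2 r, n i := by
      refine sum_congr rfl fun i hi => min_eq_left ?_
      rw [mem_Ico] at hi
      exact (hmono 2 i hi.1 hi.2).trans hn
    omega
  · have : min (n 2) t ≤ ∑ i ∈ Ico 2 r, min (n i) t :=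
      single_le_sum (f := fun i => min (n i) t) (fun _ _ => Nat.zero_le _)
        (mem_Ico.2 ⟨le_rfl, by omega⟩)
    omega

theorem card_filter_part (q : ℕ → Prop) [DecidablePred q] :
    #{v : (i : Fin r) × Fin (n i) | q v.1} = ∑ i ∈ range r with q i, n i := by
  have : ({v : (i : Fin r) × Fin (n i) | q v.1} : Finset _) =
      (univ.filter fun i : Fin r => q i).sigma fun _ => univ := by
    ext v
    simp
  rw [this, card_sigma, sum_filter, sum_filter,
    ← Fin.sum_univ_eq_sum_range (fun i => if q i then n i else 0)]
  simp

theorem card_parts : Fintype.card ((i : Fin r) × Fin (n i)) = ∑ i ∈ range r, n i := by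
  rw [Fintype.card_sigma, ← Fin.sum_univ_eq_sum_range]
  simp

theorem le_of_roomForTriangles {m : ℕ}
    (h : RoomForTriangles (fun v : (i : Fin r) × Fin (n i) => (v.1 : ℕ)) univ m) :
    m ≤ min (min ((∑ i ∈ range r, n i) / 3) ((∑ i ∈ Ico 1 r, n i) / 2)) (∑ i ∈ Ico 2 r, n i) := by
  obtain ⟨h0, h1, h2⟩ := h
  have h1 := h1 0
  have h2 := h2 0 1
  rw [card_univ, card_parts] at h0
  rw [card_filter_part fun i => i ≠ 0, show {i ∈ range r | i ≠ 0} = Ico 1 r by grind] at h1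
  rw [card_filter_part fun i => i ≠ 0 ∧ i ≠ 1,
    show {i ∈ range r | i ≠ 0 ∧ i ≠ 1} = Ico 2 r by grind] at h2
  omega

theorem Kpartite_adj {u v : (i : Fin r) × Fin (n i)} :
    (Kpartite r n).Adj u v ↔ (u.1 : ℕ) ≠ v.1 := by
  simp [Kpartite, Fin.val_inj]

theorem noRainbowC4_of_not_rainbowC4 {α : Type*} {c : Sym2 ((i : Fin r) × Fin (n i)) → α}
    (hc : ¬ RainbowC4 (Kpartite r n) c) :
    NoRainbowC4 (fun v : (i : Fin r) × Fin (n i) => (v.1 : ℕ)) fun u v => c s(u, v) := by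
  intro a b d e hab hbd hde hea had hbe
  by_contra! hne
  exact hc ⟨a, b, d, e, Kpartite_adj.2 hab, Kpartite_adj.2 hbd, Kpartite_adj.2 hde,
    Kpartite_adj.2 hea, had, hbe, hne⟩

/-- The upper bound for colourings with an arbitrary set of colours. -/
theorem card_edgeColors_lt (hr : 3 ≤ r) (hpos : ∀ i : ℕ, i < r → 1 ≤ n i) {α : Type*}
    [DecidableEq α] {f : (i : Fin r) × Fin (n i) → (i : Fin r) × Fin (n i) → α}
    (hf : ∀ u v, f u v = f v u) (hC : NoRainbowC4 (fun v => (v.1 : ℕ)) f) :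
    #(edgeColors (fun v => (v.1 : ℕ)) f univ) < (∑ i ∈ range r, n i) +
      min (min ((∑ i ∈ range r, n i) / 3) ((∑ i ∈ Ico 1 r, n i) / 2)) (∑ i ∈ Ico 2 r, n i) := by
  obtain ⟨m, hm, hlt⟩ := exists_card_edgeColors_lt hf hC
    (univ_nonempty_iff.2 ⟨⟨⟨0, by omega⟩, ⟨0, hpos 0 (by omega)⟩⟩⟩)
  rw [card_univ, card_parts] at hlt
  have := le_of_roomForTriangles hm
  omega

end Parts

/-- The anti-Ramsey number of `C₄` in the complete `r`-partite graph `K_{n₁,…,n_r}`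
equals `n₁ + ⋯ + n_r + t − 1` where
`t = min{⌊(n₁+⋯+n_r)/3⌋, ⌊(n₂+⋯+n_r)/2⌋, n₃+⋯+n_r}`. -/
theorem antiRamsey_C4_complete_multipartite (r : ℕ) (n : ℕ → ℕ) (hr : 3 ≤ r)
    (hmono : ∀ i j : ℕ, i ≤ j → j < r → n j ≤ n i)
    (hpos : ∀ i : ℕ, i < r → 1 ≤ n i) :
    IsGreatest {k : ℕ |
      ∃ c : Sym2 ((i : Fin r) × Fin (n i)) → Fin k,
        SurjOnEdges (Kpartite r n) c ∧ ¬ RainbowC4 (Kpartite r n) c}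
      ((∑ i ∈ Finset.range r, n i) +
        min (min ((∑ i ∈ Finset.range r, n i) / 3) ((∑ i ∈ Finset.Ico 1 r, n i) / 2))
          (∑ i ∈ Finset.Ico 2 r, n i) - 1) := by
  generalize ht : min (min ((∑ i ∈ range r, n i) / 3) ((∑ i ∈ Ico 1 r, n i) / 2))
    (∑ i ∈ Ico 2 r, n i) = t
  have hupper : ∀ {α : Type} [DecidableEq α]
      {f : (i : Fin r) × Fin (n i) → (i : Fin r) × Fin (n i) → α}, (∀ u v, f u v = f v u) →
      NoRainbowC4 (fun v => (v.1 : ℕ)) f →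
      #(edgeColors (fun v => (v.1 : ℕ)) f univ) < (∑ i ∈ range r, n i) + t :=
    fun hf hC => ht ▸ card_edgeColors_lt hr hpos hf hC
  have hsplit : ∑ i ∈ Ico 1 r, n i = n 1 + ∑ i ∈ Ico 2 r, n i :=
    sum_eq_sum_Ico_succ_bot (by omega) n
  have hsplit' : ∑ i ∈ range r, n i = n 0 + ∑ i ∈ Ico 1 r, n i := by
    rw [range_eq_Ico]
    exact sum_eq_sum_Ico_succ_bot (by omega) n
  have h2 : 1 ≤ ∑ i ∈ Ico 2 r, n i := (hpos 2 (by omega)).trans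
    (single_le_sum (fun _ _ => Nat.zero_le _) (mem_Ico.2 ⟨le_rfl, by omega⟩))
  have h0 := hpos 0 (by omega)
  have h1 := hpos 1 (by omega)
  have ht1 : 1 ≤ t := by omega
  constructor
  · obtain ⟨g, hinj, hg⟩ := exists_disjoint_triangles
      (three_mul_le_sum_min (n := n) (t := t) hr hmono (by omega) (by omega) (by omega))
    obtain ⟨f, hf, hC, hle⟩ := exists_coloring_of_triangles
      (p := fun v : (i : Fin r) × Fin (n i) => (v.1 : ℕ)) ht1 hinj
      (fun i a b hab h => hg i a b hab (Fin.ext h))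
    have hlt := hupper hf hC
    rw [card_parts] at hle
    set I := edgeColors (fun v : (i : Fin r) × Fin (n i) => (v.1 : ℕ)) f univ with hI
    have hcard : #I = (∑ i ∈ range r, n i) + t - 1 := by omega
    let e : I ≃ Fin ((∑ i ∈ range r, n i) + t - 1) := I.equivFinOfCardEq hcard
    let F : Sym2 ((i : Fin r) × Fin (n i)) → ℕ ⊕ ℕ × ℕ := Sym2.lift ⟨f, hf⟩
    have hF : ∀ u v, F s(u, v) = f u v := fun u v => rfl
    let c : Sym2 ((i : Fin r) × Fin (n i)) → Fin ((∑ i ∈ range r, n i) + t - 1) :=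
      fun x => if h : F x ∈ I then e ⟨F x, h⟩ else ⟨0, by omega⟩
    have hc : ∀ {u v u' v'}, c s(u, v) ≠ c s(u', v') → f u v ≠ f u' v' := by
      intro u v u' v' hne he
      exact hne (by simp only [c, hF, he])
    refine ⟨c, fun k => ?_, ?_⟩
    · obtain ⟨u, -, v, -, huv, he⟩ := mem_edgeColors.1 (e.symm k).2
      refine ⟨s(u, v), Kpartite_adj.2 huv, ?_⟩
      have hk : F s(u, v) = e.symm k := he
      simp only [c, hk, Subtype.coe_eta, Equiv.apply_symm_apply]
      exact dif_pos (e.symm k).2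
    · rintro ⟨a, b, d, x, hab, hbd, hdx, hxa, had, hbx, q1, q2, q3, q4, q5, q6⟩
      have := hC a b d x (Kpartite_adj.1 hab) (Kpartite_adj.1 hbd) (Kpartite_adj.1 hdx)
        (Kpartite_adj.1 hxa) had hbx
      have := hc q1
      have := hc q2
      have := hc q3
      have := hc q4
      have := hc q5
      have := hc q6
      tauto
  · rintro k ⟨c, hsurj, hc⟩
    have hlt := hupper (f := fun u v => c s(u, v)) (fun u v => by rw [Sym2.eq_swap])
      (noRainbowC4_of_not_rainbowC4 hc)
    have huniv : edgeColors (fun v : (i : Fin r) × Fin (n i) => (v.1 : ℕ))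
        (fun u v => c s(u, v)) univ = univ := by
      rw [eq_univ_iff_forall]
      intro i
      obtain ⟨x, hx, hi⟩ := hsurj i
      induction x using Sym2.ind with
      | _ u v => exact mem_edgeColors.2 ⟨u, mem_univ _, v, mem_univ _, Kpartite_adj.1 hx, hi⟩
    rw [huniv, card_univ, Fintype.card_fin] at hlt
    omega
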